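/- The map x ↦ CRD(x) is a bijection from the affine symmetric group S̃_{k+1} onto the set of k-codes, i.e., onto the set of functions α : I → ℕ such that α_i = 0 for at least one i ∈ I. -/

import Mathlib

/-- `x : Equiv.Perm ℤ` is an affine permutation in `S̃_{k+1}`: it commutes with
translation by `k+1` and its window sums to `(k+1)(k+2)/2`. -/
def IsAffinePerm (k : ℕ) (x : Equiv.Perm ℤ) : Prop :=
  (∀ i : ℤ, x (i + (k + 1)) = x i + (k + 1)) ∧
  ∑ i ∈ Finset.Icc (1 : ℤ) (k + 1), x i = (k + 1) * (k + 2) / 2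

/-- The underlying function of the simple generator `s_i`. -/
def sAffFun (k : ℕ) (i : ZMod (k + 1)) (j : ℤ) : ℤ :=
  if (j : ZMod (k + 1)) = i then j + 1
  else if (j : ZMod (k + 1)) = i + 1 then j - 1
  else j

theorem sAffFun_invol (k : ℕ) (i : ZMod (k + 1)) (h : ¬ (1 : ZMod (k + 1)) = 0) :
    Function.Involutive (sAffFun k i) := by
  have hne : i + 1 ≠ i := fun hc => h (by
    have h2 : i + 1 = i + 0 := by simpa using hc
    exact add_left_cancel h2)
  intro j
  by_cases h1 : (j : ZMod (k + 1)) = i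
  · have e1 : sAffFun k i j = j + 1 := if_pos h1
    have hj1 : ((j + 1 : ℤ) : ZMod (k + 1)) = i + 1 := by push_cast; rw [h1]
    have e2 : sAffFun k i (j + 1) = j := by
      unfold sAffFun
      rw [if_neg (by rw [hj1]; exact hne), if_pos hj1]
      ring
    rw [e1, e2]
  · by_cases h2 : (j : ZMod (k + 1)) = i + 1
    · have e1 : sAffFun k i j = j - 1 := by unfold sAffFun; rw [if_neg h1, if_pos h2]
      have hj1 : ((j - 1 : ℤ) : ZMod (k + 1)) = i := by push_cast; rw [h2]; ring
      have e2 : sAffFun k i (j - 1) = j := by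
        unfold sAffFun; rw [if_pos hj1]; ring
      rw [e1, e2]
    · have e1 : sAffFun k i j = j := by unfold sAffFun; rw [if_neg h1, if_neg h2]
      rw [e1, e1]

/-- The simple generator `s_i` of the affine symmetric group, as a permutation of `ℤ`:
it interchanges `m(k+1) + ī` and `m(k+1) + ī + 1` for every `m` (when `k ≥ 1`). -/
noncomputable def sAff (k : ℕ) (i : ZMod (k + 1)) : Equiv.Perm ℤ :=
  if h : (1 : ZMod (k + 1)) = 0 then 1 else Function.Involutive.toPerm _ (sAffFun_invol k i h)

/-- The Coxeter length of `x`: the least number of simple generators whose product is `x`. -/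
noncomputable def affLen (k : ℕ) (x : Equiv.Perm ℤ) : ℕ :=
  sInf {n : ℕ | ∃ w : List (ZMod (k + 1)), w.length = n ∧ x = (w.map (sAff k)).prod}

/-- The right descent set `D_R(x) = {i : ℓ(x s_i) < ℓ(x)}`. -/
noncomputable def rightDescents (k : ℕ) (x : Equiv.Perm ℤ) : Set (ZMod (k + 1)) :=
  {i | affLen k (x * sAff k i) < affLen k x}

/-- The cyclic interval `[i,j] = {i, i+1, …, j}` of residues mod `k+1`. -/
def cycInt (k : ℕ) (i j : ZMod (k + 1)) : Finset (ZMod (k + 1)) :=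
  (Finset.range ((j - i).val + 1)).image fun t : ℕ => i + (t : ZMod (k + 1))

/-- A choice of a "gate" residue not belonging to `A` (when `A` is proper). -/
noncomputable def gate (k : ℕ) (A : Finset (ZMod (k + 1))) : ZMod (k + 1) :=
  if h : ∃ g, g ∉ A then h.choose else 0

/-- The cyclically decreasing element `d_A`: the product of the `s_a`, `a ∈ A`, in an
order where `s_{a+1}` occurs to the left of `s_a` whenever `a, a+1 ∈ A`. -/
noncomputable def dElt (k : ℕ) (A : Finset (ZMod (k + 1))) : Equiv.Perm ℤ :=
  (((((List.range (k + 1)).reverse.map fun t : ℕ => gate k A + (t : ZMod (k + 1))).filter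
      fun a => decide (a ∈ A)).map (sAff k)).prod)

/-- The cyclically increasing element `u_A`: the product of the `s_a`, `a ∈ A`, in an
order where `s_{a+1}` occurs to the right of `s_a` whenever `a, a+1 ∈ A`. -/
noncomputable def uElt (k : ℕ) (A : Finset (ZMod (k + 1))) : Equiv.Perm ℤ :=
  ((((List.range (k + 1)).map fun t : ℕ => gate k A + (t : ZMod (k + 1))).filter
      fun a => decide (a ∈ A)).map (sAff k)).prod

/-- The right decreasing code: `CRD(x)_i = #{j < ī : x(j) > x(ī)}`. -/
noncomputable def CRD (k : ℕ) (x : Equiv.Perm ℤ) (i : ZMod (k + 1)) : ℕ :=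
  Set.ncard {j : ℤ | j < (i.val : ℤ) ∧ x (i.val : ℤ) < x j}

/-- The right increasing code: `CRI(x)_i = #{j > ī + 1 : x(j) < x(ī + 1)}`. -/
noncomputable def CRI (k : ℕ) (x : Equiv.Perm ℤ) (i : ZMod (k + 1)) : ℕ :=
  Set.ncard {j : ℤ | (i.val : ℤ) + 1 < j ∧ x j < x ((i.val : ℤ) + 1)}

/-- The left decreasing code: `CLD(x)_i = #{j < x⁻¹(ī + 1) : x(j) > ī + 1}`. -/
noncomputable def CLD (k : ℕ) (x : Equiv.Perm ℤ) (i : ZMod (k + 1)) : ℕ :=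
  Set.ncard {j : ℤ | j < x.symm ((i.val : ℤ) + 1) ∧ (i.val : ℤ) + 1 < x j}

/-- The left increasing code: `CLI(x)_i = #{j > x⁻¹(ī) : x(j) < ī}`. -/
noncomputable def CLI (k : ℕ) (x : Equiv.Perm ℤ) (i : ZMod (k + 1)) : ℕ :=
  Set.ncard {j : ℤ | x.symm ((i.val : ℤ)) < j ∧ x j < (i.val : ℤ)}

theorem sAff_apply {k : ℕ} (h1 : (1 : ZMod (k + 1)) ≠ 0) (i : ZMod (k + 1)) (j : ℤ) :
    sAff k i j = sAffFun k i j := by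
  unfold sAff
  rw [dif_neg h1]
  rfl

theorem sAff_sAff {k : ℕ} (h1 : (1 : ZMod (k + 1)) ≠ 0) (i : ZMod (k + 1)) (j : ℤ) :
    sAff k i (sAff k i j) = j := by
  rw [sAff_apply h1, sAff_apply h1]
  exact sAffFun_invol k i h1 j

theorem sAff_mul_self {k : ℕ} (h1 : (1 : ZMod (k + 1)) ≠ 0) (i : ZMod (k + 1)) :
    sAff k i * sAff k i = 1 :=
  Equiv.ext fun j => sAff_sAff h1 i j

theorem sAff_of_eq {k : ℕ} (h1 : (1 : ZMod (k + 1)) ≠ 0) {i : ZMod (k + 1)} {j : ℤ}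
    (h : (j : ZMod (k + 1)) = i) : sAff k i j = j + 1 := by
  rw [sAff_apply h1, sAffFun, if_pos h]

theorem sAff_of_eq_add_one {k : ℕ} (h1 : (1 : ZMod (k + 1)) ≠ 0) {i : ZMod (k + 1)} {j : ℤ}
    (h : (j : ZMod (k + 1)) = i + 1) : sAff k i j = j - 1 := by
  rw [sAff_apply h1, sAffFun, if_neg (by rw [h]; simpa using h1), if_pos h]

theorem sAff_of_ne {k : ℕ} (h1 : (1 : ZMod (k + 1)) ≠ 0) {i : ZMod (k + 1)} {j : ℤ}
    (h : (j : ZMod (k + 1)) ≠ i) (h' : (j : ZMod (k + 1)) ≠ i + 1) : sAff k i j = j := by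
  rw [sAff_apply h1, sAffFun, if_neg h, if_neg h']

/-- A generator preserves every initial segment that does not cut one of its swapped pairs. -/
theorem sAff_lt {k : ℕ} (h1 : (1 : ZMod (k + 1)) ≠ 0) {i : ZMod (k + 1)} {j m : ℤ}
    (hm : (m : ZMod (k + 1)) ≠ i + 1) (hj : j < m) : sAff k i j < m := by
  by_cases h : (j : ZMod (k + 1)) = i
  · rw [sAff_of_eq h1 h]
    refine lt_of_le_of_ne hj fun hc => hm ?_
    rw [← hc]
    push_cast
    rw [h]
  · by_cases h' : (j : ZMod (k + 1)) = i + 1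
    · rw [sAff_of_eq_add_one h1 h']
      omega
    · rwa [sAff_of_ne h1 h h']

/-- A function of period `n` on `ℤ` factors through residues. -/
theorem periodic_eq_val {k : ℕ} {β : Type*} {f : ℤ → β} (hf : ∀ j : ℤ, f (j + (k + 1)) = f j)
    {a b : ℤ} (hab : (a : ZMod (k + 1)) = b) : f a = f b := by
  have hp : Function.Periodic f ((k : ℤ) + 1) := hf
  have hd : (((k + 1 : ℕ) : ℤ)) ∣ b - a := (ZMod.intCast_eq_intCast_iff_dvd_sub a b (k + 1)).1 hab
  obtain ⟨c, hc⟩ := hd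
  have hb : b = a + c * ((k : ℤ) + 1) := by push_cast at hc; linarith
  rw [hb]
  exact (hp.int_mul c a).symm

theorem cast_val_eq {k : ℕ} (r : ZMod (k + 1)) : (((r.val : ℕ) : ℤ) : ZMod (k + 1)) = r := by
  rw [Int.cast_natCast, ZMod.natCast_zmod_val]

theorem sum_Icc_cast {k : ℕ} (g : ZMod (k + 1) → ℤ) :
    ∑ j ∈ Finset.Icc (1 : ℤ) (k + 1), g j = ∑ r, g r := by
  refine Finset.sum_nbij (fun j : ℤ => (j : ZMod (k + 1))) (fun _ _ => Finset.mem_univ _)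
    ?_ ?_ (fun _ _ => rfl)
  · intro a ha b hb hab
    simp only [Finset.coe_Icc, Set.mem_Icc] at ha hb
    have hd := (ZMod.intCast_eq_intCast_iff_dvd_sub a b (k + 1)).1 hab
    have := Int.eq_zero_of_abs_lt_dvd hd (by push_cast; rw [abs_lt]; constructor <;> linarith)
    omega
  · intro r _
    have hlt := ZMod.val_lt r
    by_cases h0 : r.val = 0
    · refine ⟨(k : ℤ) + 1, ?_, ?_⟩
      · simp only [Finset.coe_Icc, Set.mem_Icc]; omega
      · rw [(ZMod.val_eq_zero r).1 h0]
        exact_mod_cast ZMod.natCast_self (k + 1)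
    · refine ⟨r.val, ?_, cast_val_eq r⟩
      simp only [Finset.coe_Icc, Set.mem_Icc]
      omega

theorem sum_Icc_id (k : ℕ) :
    ∑ j ∈ Finset.Icc (1 : ℤ) (k + 1), j = ((k : ℤ) + 1) * (k + 2) / 2 := by
  have key : ∀ m : ℕ, 2 * ∑ j ∈ Finset.Icc (1 : ℤ) m, j = (m : ℤ) * (m + 1) := by
    intro m
    induction m with
    | zero => simp
    | succ m ih =>
      have : Finset.Icc (1 : ℤ) ((m + 1 : ℕ) : ℤ) = insert ((m : ℤ) + 1) (Finset.Icc 1 (m : ℤ)) := by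
        ext; simp only [Finset.mem_insert, Finset.mem_Icc]; omega
      rw [this, Finset.sum_insert (by simp), mul_add, ih]
      push_cast
      ring
  have h := key (k + 1)
  push_cast at h
  have e : ((k : ℤ) + 1) * (k + 2) = 2 * ∑ j ∈ Finset.Icc (1 : ℤ) (k + 1), j := by rw [h]; ring
  rw [e, Int.mul_ediv_cancel_left _ (by norm_num)]

/-- The window condition says that the displacements sum to zero over the residues. -/
theorem isAffinePerm_iff {k : ℕ} {x : Equiv.Perm ℤ} :
    IsAffinePerm k x ↔ (∀ i : ℤ, x (i + (k + 1)) = x i + (k + 1)) ∧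
      ∑ r : ZMod (k + 1), (x r.val - r.val) = 0 := by
  refine and_congr_right fun hx => ?_
  rw [← sum_Icc_cast, ← sum_Icc_id, ← sub_eq_zero, ← Finset.sum_sub_distrib]
  rw [Finset.sum_congr rfl fun j _ => ?_]
  exact periodic_eq_val (f := fun j => x j - j) (fun j => by simp only [hx]; ring)
    (cast_val_eq (j : ZMod (k + 1))).symm

theorem IsAffinePerm.displacement {k : ℕ} {x : Equiv.Perm ℤ} (hx : IsAffinePerm k x)
    {a b : ℤ} (hab : (a : ZMod (k + 1)) = b) : x a - a = x b - b :=
  periodic_eq_val (f := fun j => x j - j) (fun j => by simp only [hx.1]; ring) hab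

theorem sAff_add_period {k : ℕ} (h1 : (1 : ZMod (k + 1)) ≠ 0) (i : ZMod (k + 1)) (j : ℤ) :
    sAff k i (j + (k + 1)) = sAff k i j + (k + 1) := by
  have hc : ((j + (k + 1) : ℤ) : ZMod (k + 1)) = j := by
    have := ZMod.natCast_self (k + 1)
    push_cast at this ⊢
    rw [this, add_zero]
  rw [sAff_apply h1, sAff_apply h1]
  unfold sAffFun
  rw [hc]
  split_ifs <;> ring

theorem sAff_cast {k : ℕ} (h1 : (1 : ZMod (k + 1)) ≠ 0) (i : ZMod (k + 1)) (j : ℤ) :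
    ((sAff k i j : ℤ) : ZMod (k + 1)) = Equiv.swap i (i + 1) (j : ZMod (k + 1)) := by
  by_cases h : (j : ZMod (k + 1)) = i
  · rw [sAff_of_eq h1 h, h, Equiv.swap_apply_left]
    push_cast
    rw [h]
  · by_cases h' : (j : ZMod (k + 1)) = i + 1
    · rw [sAff_of_eq_add_one h1 h', h', Equiv.swap_apply_right]
      push_cast
      rw [h', add_sub_cancel_right]
    · rw [sAff_of_ne h1 h h', Equiv.swap_apply_of_ne_of_ne h h']

theorem sum_sAff_displacement {k : ℕ} (h1 : (1 : ZMod (k + 1)) ≠ 0) (i : ZMod (k + 1)) :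
    ∑ r : ZMod (k + 1), (sAff k i r.val - r.val) = 0 := by
  have hne : i + 1 ≠ i := by simpa using h1
  have h : ∀ r : ZMod (k + 1), sAff k i r.val - r.val =
      (if r = i then 1 else 0) - (if r = i + 1 then 1 else 0) := by
    intro r
    by_cases h : r = i
    · rw [sAff_of_eq h1 ((cast_val_eq r).trans h), if_pos h, if_neg (by rw [h]; exact hne.symm)]
      ring
    · by_cases h' : r = i + 1
      · rw [sAff_of_eq_add_one h1 ((cast_val_eq r).trans h'), if_neg h, if_pos h']
        ring
      · rw [sAff_of_ne h1 (by rwa [cast_val_eq]) (by rwa [cast_val_eq]), if_neg h, if_neg h']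
        ring
  simp_rw [h]
  simp [Finset.sum_sub_distrib]

theorem IsAffinePerm.mul_sAff {k : ℕ} (h1 : (1 : ZMod (k + 1)) ≠ 0) {x : Equiv.Perm ℤ}
    (hx : IsAffinePerm k x) (i : ZMod (k + 1)) : IsAffinePerm k (x * sAff k i) := by
  refine isAffinePerm_iff.2 ⟨fun j => ?_, ?_⟩
  · rw [Equiv.Perm.mul_apply, Equiv.Perm.mul_apply, sAff_add_period h1, hx.1]
  · have h : ∀ r : ZMod (k + 1), (x * sAff k i) r.val - r.val =
        (x (Equiv.swap i (i + 1) r).val - (Equiv.swap i (i + 1) r).val) +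
          (sAff k i r.val - r.val) := by
      intro r
      rw [Equiv.Perm.mul_apply, hx.displacement (b := sAff k i r.val)
        (by rw [cast_val_eq, sAff_cast h1, cast_val_eq])]
      ring
    simp_rw [h]
    rw [Finset.sum_add_distrib, sum_sAff_displacement h1, add_zero,
      Equiv.sum_comp (Equiv.swap i (i + 1)) (fun r : ZMod (k + 1) => x r.val - r.val)]
    exact (isAffinePerm_iff.1 hx).2

theorem isAffinePerm_one (k : ℕ) : IsAffinePerm k 1 :=
  isAffinePerm_iff.2 ⟨fun _ => rfl, by simp⟩

theorem IsAffinePerm.exists_displacement_le {k : ℕ} {x : Equiv.Perm ℤ} (hx : IsAffinePerm k x) :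
    ∃ M : ℤ, ∀ j, x j - j ≤ M := by
  obtain ⟨M, hM⟩ := (Set.finite_range fun r : ZMod (k + 1) => x r.val - r.val).bddAbove
  refine ⟨M, fun j => ?_⟩
  rw [hx.displacement (cast_val_eq (j : ZMod (k + 1))).symm]
  exact hM ⟨_, rfl⟩

theorem IsAffinePerm.finite_inversions {k : ℕ} {x : Equiv.Perm ℤ} (hx : IsAffinePerm k x) (a : ℤ) :
    {j : ℤ | j < a ∧ x a < x j}.Finite := by
  obtain ⟨M, hM⟩ := hx.exists_displacement_le
  refine (Set.finite_Icc (x a - M) a).subset fun j hj => ?_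
  have := hM j
  exact ⟨by linarith [hj.2], hj.1.le⟩

theorem IsAffinePerm.CRD_cast {k : ℕ} {x : Equiv.Perm ℤ} (hx : IsAffinePerm k x) (a : ℤ) :
    CRD k x a = Set.ncard {j : ℤ | j < a ∧ x a < x j} := by
  refine periodic_eq_val (f := fun a : ℤ => Set.ncard {j : ℤ | j < a ∧ x a < x j}) (fun a => ?_)
    (cast_val_eq (a : ZMod (k + 1)))
  have h : {j : ℤ | j < a + (k + 1) ∧ x (a + (k + 1)) < x j} =
      (Equiv.addRight ((k : ℤ) + 1)) '' {j : ℤ | j < a ∧ x a < x j} := by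
    ext j
    rw [Equiv.image_eq_preimage_symm]
    have := hx.1 (j - (k + 1))
    rw [sub_add_cancel] at this
    simp only [Set.mem_ofPred_eq, Set.mem_preimage, Equiv.addRight_symm, Equiv.coe_addRight,
      ← sub_eq_add_neg, hx.1 a, this]
    constructor <;> rintro ⟨_, _⟩ <;> constructor <;> linarith
  simp only [h]
  exact Set.ncard_image_of_injective _ (Equiv.injective _)

theorem IsAffinePerm.exists_CRD_eq_zero {k : ℕ} {x : Equiv.Perm ℤ} (hx : IsAffinePerm k x) :
    ∃ i, CRD k x i = 0 := by
  obtain ⟨M, hM⟩ := hx.exists_displacement_le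
  obtain ⟨_, ⟨a, ha, rfl⟩, hmax⟩ := Int.exists_greatest_of_bdd (P := fun v => ∃ j ≤ 0, x j = v)
    ⟨M, by rintro _ ⟨j, hj, rfl⟩; linarith [hM j]⟩ ⟨x 0, 0, le_rfl, rfl⟩
  refine ⟨(a : ZMod (k + 1)), ?_⟩
  rw [hx.CRD_cast, Set.ncard_eq_zero (hx.finite_inversions a)]
  refine Set.eq_empty_of_forall_notMem fun j hj => ?_
  exact (hmax _ ⟨j, by linarith [hj.1], rfl⟩).not_gt hj.2

theorem CRD_one (k : ℕ) : CRD k 1 = 0 := by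
  funext i
  refine (congrArg Set.ncard ?_).trans (Set.ncard_empty ℤ)
  refine Set.eq_empty_of_forall_notMem fun j hj => ?_
  exact lt_asymm hj.1 hj.2

theorem IsAffinePerm.eq_one_of_CRD_eq_zero {k : ℕ} {x : Equiv.Perm ℤ} (hx : IsAffinePerm k x)
    (h : CRD k x = 0) : x = 1 := by
  have hmono : StrictMono x := by
    intro a b hab
    by_contra hc
    have hlt : x b < x a := lt_of_le_of_ne (not_lt.1 hc) fun e => hab.ne' (x.injective e)
    have h0 : CRD k x (b : ZMod (k + 1)) = 0 := congrFun h _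
    rw [hx.CRD_cast, Set.ncard_eq_zero (hx.finite_inversions b)] at h0
    exact Set.notMem_empty a (h0 ▸ ⟨hab, hlt⟩)
  let e : ℤ ≃o ℤ := hmono.orderIsoOfSurjective x x.surjective
  have hs : ∀ j : ℤ, x (j + 1) = x j + 1 := fun j => e.map_succ j
  have hall : ∀ j : ℤ, x j - j = x 0 := by
    intro j
    have hp : Function.Periodic (fun j => x j - j) (1 : ℤ) := fun j => by simp only [hs]; ring
    simpa using hp.int_mul j 0
  have hsum := (isAffinePerm_iff.1 hx).2
  simp_rw [hall] at hsum
  have h0 : x 0 = 0 := by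
    rw [Finset.sum_const, Finset.card_univ, ZMod.card, nsmul_eq_mul] at hsum
    exact (mul_eq_zero.1 hsum).resolve_left (by positivity)
  ext j
  have := hall j
  rw [h0] at this
  rw [Equiv.Perm.one_apply]
  linarith

/-- The effect on codes of removing the right descent `i`. -/
def descentMove {k : ℕ} (i : ZMod (k + 1)) (α : ZMod (k + 1) → ℕ) : ZMod (k + 1) → ℕ :=
  fun m => if m = i then α (i + 1) - 1 else if m = i + 1 then α i else α m

theorem descentMove_injOn {k : ℕ} (h1 : (1 : ZMod (k + 1)) ≠ 0) (i : ZMod (k + 1)) :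
    Set.InjOn (descentMove i) {α | α i < α (i + 1)} := by
  have hne : i + 1 ≠ i := by simpa using h1
  intro α hα β hβ h
  simp only [Set.mem_ofPred_eq] at hα hβ
  funext m
  have ei := congrFun h i
  have ei1 := congrFun h (i + 1)
  have em := congrFun h m
  simp only [descentMove, if_pos, if_neg hne] at ei ei1 em
  by_cases hm : m = i
  · rw [hm, ei1]
  · by_cases hm' : m = i + 1
    · rw [hm']
      omega
    · rwa [if_neg hm, if_neg hm', if_neg hm, if_neg hm'] at em

theorem sum_descentMove_lt {k : ℕ} (h1 : (1 : ZMod (k + 1)) ≠ 0) {i : ZMod (k + 1)}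
    {α : ZMod (k + 1) → ℕ} (hα : α i < α (i + 1)) : ∑ m, descentMove i α m < ∑ m, α m := by
  rw [← Equiv.sum_comp (Equiv.swap i (i + 1)) α]
  refine Finset.sum_lt_sum (fun m _ => ?_) ⟨i, Finset.mem_univ _, ?_⟩
  · by_cases hm : m = i
    · simp [descentMove, hm]
    · by_cases hm' : m = i + 1
      · simp [descentMove, hm', h1]
      · simp [descentMove, hm, hm', Equiv.swap_apply_of_ne_of_ne hm hm']
  · simp only [descentMove, if_pos, Equiv.swap_apply_left]
    omega

theorem exists_descentMove_eq_zero {k : ℕ} (h1 : (1 : ZMod (k + 1)) ≠ 0) {i : ZMod (k + 1)}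
    {α : ZMod (k + 1) → ℕ} (hα : α i < α (i + 1)) (h0 : ∃ z, α z = 0) :
    ∃ z, descentMove i α z = 0 := by
  have hne : i + 1 ≠ i := by simpa using h1
  obtain ⟨z, hz⟩ := h0
  by_cases hzi : z = i
  · refine ⟨i + 1, ?_⟩
    simp only [descentMove, if_neg hne, if_pos]
    rw [← hzi, hz]
  · refine ⟨z, ?_⟩
    have : z ≠ i + 1 := by
      rintro rfl
      omega
    simp only [descentMove, if_neg hzi, if_neg this, hz]

theorem exists_ascent_of_ne_zero {k : ℕ} {α : ZMod (k + 1) → ℕ} (h0 : ∃ z, α z = 0)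
    (hα : α ≠ 0) : ∃ i, α i < α (i + 1) := by
  by_contra! hc
  obtain ⟨z, hz⟩ := h0
  refine hα (funext fun m => ?_)
  have h : ∀ t : ℕ, α (z + t) = 0 := by
    intro t
    induction t with
    | zero => simpa using hz
    | succ t ih =>
      have := hc (z + t)
      rw [ih, add_assoc] at this
      push_cast
      exact Nat.le_zero.1 this
  have := h (m - z).val
  rwa [ZMod.natCast_zmod_val, add_sub_cancel] at this

theorem IsAffinePerm.CRD_lt_iff {k : ℕ} {x : Equiv.Perm ℤ} (hx : IsAffinePerm k x) (a : ℤ) :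
    CRD k x a < CRD k x (a + 1) ↔ x (a + 1) < x a := by
  have e : ((a : ZMod (k + 1)) + 1) = ((a + 1 : ℤ) : ZMod (k + 1)) := by push_cast; rfl
  rw [e, hx.CRD_cast, hx.CRD_cast]
  constructor
  · intro h
    by_contra! hc
    refine h.not_ge (Set.ncard_le_ncard (fun j hj => ?_) (hx.finite_inversions a))
    have hja : j ≠ a := by
      rintro rfl
      exact hj.2.not_ge hc
    have := hj.1
    exact ⟨by omega, hc.trans_lt hj.2⟩
  · intro h
    refine Set.ncard_lt_ncard ⟨fun j hj => ⟨hj.1.trans (lt_add_one a), h.trans hj.2⟩, fun hs => ?_⟩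
      (hx.finite_inversions (a + 1))
    exact lt_irrefl _ (hs (show a ∈ _ from ⟨lt_add_one a, h⟩)).1

theorem IsAffinePerm.CRD_mul_sAff {k : ℕ} (h1 : (1 : ZMod (k + 1)) ≠ 0) {x : Equiv.Perm ℤ}
    (hx : IsAffinePerm k x) {a : ℤ} (ha : x (a + 1) < x a) :
    CRD k (x * sAff k a) = descentMove (a : ZMod (k + 1)) (CRD k x) := by
  have hne : (a : ZMod (k + 1)) + 1 ≠ a := by simpa using h1
  have hx' := hx.mul_sAff h1 (a : ZMod (k + 1))
  have e : ((a : ZMod (k + 1)) + 1) = ((a + 1 : ℤ) : ZMod (k + 1)) := by push_cast; rfl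
  set s := sAff k (a : ZMod (k + 1)) with hs
  have sa : s a = a + 1 := sAff_of_eq h1 rfl
  have sa1 : s (a + 1) = a := by
    rw [hs, sAff_of_eq_add_one h1 e.symm]
    ring
  have ss : ∀ j, s (s j) = j := sAff_sAff h1 _
  have image_s : ∀ A : Set ℤ, s '' A = {j | s j ∈ A} := by
    intro A
    ext j
    exact ⟨by rintro ⟨j, hj, rfl⟩; rwa [Set.mem_ofPred_eq, ss], fun hj => ⟨s j, hj, ss j⟩⟩
  have s_lt : ∀ {m : ℤ}, (m : ZMod (k + 1)) ≠ a + 1 → ∀ j, s j < m ↔ j < m := fun hm j =>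
    ⟨fun h => ss j ▸ sAff_lt h1 hm h, sAff_lt h1 hm⟩
  funext m
  unfold descentMove
  split_ifs with hm hm'
  · rw [hm, e, hx'.CRD_cast, hx.CRD_cast]
    have hset : {j : ℤ | j < a + 1 ∧ x (a + 1) < x j} =
        insert a (s '' {j : ℤ | j < a ∧ (x * s) a < (x * s) j}) := by
      rw [image_s]
      ext j
      simp only [Set.mem_ofPred_eq, Set.mem_insert_iff, Equiv.Perm.mul_apply, ss, sa,
        s_lt hne.symm]
      constructor
      · rintro ⟨hj, hj'⟩
        by_cases hja : j = a
        · exact Or.inl hja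
        · exact Or.inr ⟨by omega, hj'⟩
      · rintro (rfl | ⟨hj, hj'⟩)
        · exact ⟨lt_add_one _, ha⟩
        · exact ⟨by omega, hj'⟩
    rw [hset, Set.ncard_insert_of_notMem _ ((hx'.finite_inversions a).image _),
      Set.ncard_image_of_injective _ s.injective, Nat.add_sub_cancel]
    rw [image_s]
    rintro ⟨h, -⟩
    rw [sa] at h
    omega
  · rw [hm', e, hx'.CRD_cast, hx.CRD_cast]
    have hset : {j : ℤ | j < a + 1 ∧ (x * s) (a + 1) < (x * s) j} =
        s '' {j : ℤ | j < a ∧ x a < x j} := by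
      rw [image_s]
      ext j
      simp only [Set.mem_ofPred_eq, Equiv.Perm.mul_apply, sa1, s_lt hne.symm]
      refine and_congr_left fun hj => ⟨fun h => ?_, fun h => by omega⟩
      refine lt_of_le_of_ne (Int.lt_add_one_iff.1 h) ?_
      rintro rfl
      rw [sa] at hj
      exact lt_asymm ha hj
    rw [hset, Set.ncard_image_of_injective _ s.injective]
  · obtain ⟨b, rfl⟩ : ∃ b : ℤ, (b : ZMod (k + 1)) = m := ⟨_, cast_val_eq m⟩
    have sb : s b = b := sAff_of_ne h1 hm hm'
    rw [hx'.CRD_cast, hx.CRD_cast]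
    have hset : {j : ℤ | j < b ∧ (x * s) b < (x * s) j} = s '' {j : ℤ | j < b ∧ x b < x j} := by
      rw [image_s]
      ext j
      simp only [Set.mem_ofPred_eq, Equiv.Perm.mul_apply, s_lt hm', sb]
    rw [hset, Set.ncard_image_of_injective _ s.injective]

theorem existsUnique_CRD_eq {k : ℕ} (h1 : (1 : ZMod (k + 1)) ≠ 0) (α : ZMod (k + 1) → ℕ)
    (h0 : ∃ z, α z = 0) : ∃! x : Equiv.Perm ℤ, IsAffinePerm k x ∧ CRD k x = α := by
  induction hN : ∑ m, α m using Nat.strong_induction_on generalizing α with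
  | _ N ih =>
    by_cases hα : α = 0
    · subst hα
      exact ⟨1, ⟨isAffinePerm_one k, CRD_one k⟩, fun x hx => hx.1.eq_one_of_CRD_eq_zero hx.2⟩
    obtain ⟨i, hi⟩ := exists_ascent_of_ne_zero h0 hα
    obtain ⟨a, rfl⟩ : ∃ a : ℤ, (a : ZMod (k + 1)) = i := ⟨_, cast_val_eq i⟩
    have hne : (a : ZMod (k + 1)) + 1 ≠ a := by simpa using h1
    obtain ⟨y, ⟨hy, hyc⟩, huniq⟩ := ih _ (hN ▸ sum_descentMove_lt h1 hi)
      (descentMove a α) (exists_descentMove_eq_zero h1 hi h0) rfl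
    have hss : ∀ w : Equiv.Perm ℤ, w * sAff k a * sAff k a = w := fun w => by
      rw [mul_assoc, sAff_mul_self h1, mul_one]
    refine ⟨y * sAff k a, ⟨hy.mul_sAff h1 _, ?_⟩, fun w hw => ?_⟩
    · have hx := hy.mul_sAff h1 (a : ZMod (k + 1))
      have hasc : y a < y (a + 1) := by
        refine lt_of_le_of_ne (not_lt.1 fun h => ?_) fun h => ?_
        · rw [← hy.CRD_lt_iff, hyc] at h
          simp only [descentMove, if_neg hne, if_pos] at h
          omega
        · have := y.injective h
          omega
      have hdes : (y * sAff k a) (a + 1) < (y * sAff k a) a := by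
        rw [Equiv.Perm.mul_apply, Equiv.Perm.mul_apply, sAff_of_eq h1 rfl,
          sAff_of_eq_add_one h1 (by push_cast; rfl), add_sub_cancel_right]
        exact hasc
      refine descentMove_injOn h1 a ((hx.CRD_lt_iff a).2 hdes) hi ?_
      rw [← hx.CRD_mul_sAff h1 hdes, hss, hyc]
    · have hdes : w (a + 1) < w a := by
        rw [← hw.1.CRD_lt_iff, hw.2]
        exact hi
      rw [← huniq (w * sAff k a) ⟨hw.1.mul_sAff h1 _, by rw [hw.1.CRD_mul_sAff h1 hdes, hw.2]⟩,
        hss]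

/-- `x ↦ CRD(x)` is a bijection from affine permutations onto k-codes. -/
theorem crd_bijective (k : ℕ) (hk : 1 ≤ k) :
    Set.BijOn (fun x : Equiv.Perm ℤ => CRD k x)
      {x | IsAffinePerm k x}
      {α : ZMod (k + 1) → ℕ | ∃ i, α i = 0} := by
  have h1 : (1 : ZMod (k + 1)) ≠ 0 := by
    have : Fact (1 < k + 1) := ⟨by omega⟩
    exact one_ne_zero
  refine ⟨fun x hx => hx.exists_CRD_eq_zero, fun x hx y hy h => ?_, fun α hα => ?_⟩
  · exact (existsUnique_CRD_eq h1 (CRD k y) hy.exists_CRD_eq_zero).unique ⟨hx, h⟩ ⟨hy, rfl⟩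
  · exact (existsUnique_CRD_eq h1 α hα).exists
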